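/- Let U be a nonempty closed bounded convex subset of a Banach space X and T : U → U a continuous map such that T(U) has compact closure. Then T has a fixed point in U. -/

import Mathlib

namespace Scarf

def Dom {V I L : Type*} [LinearOrder L] (k : I → V → L) (σ : Finset V) : Prop :=
  ∀ y, ∃ i, ∀ x ∈ σ, k i y ≤ k i x

lemma inner {V I L : Type*} [Fintype V] [DecidableEq V] [Fintype I] [DecidableEq I]
    [LinearOrder L] (k : I → V → L) (hk : ∀ i, Function.Injective (k i)) (e : I → V)
    (he2 : ∀ i j, j ≠ i → ∀ v, v ∉ Set.range e → k i v < k i (e j))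
    (τ : Finset V) (hτ : Dom k τ) (hcard : τ.card + 1 = Fintype.card I)
    (t : V) (ht : t ∈ τ) (hte : t ∉ Set.range e) :
    ∃ y₁ y₂, y₁ ≠ y₂ ∧ ∀ y, (y ∉ τ ∧ Dom k (insert y τ)) ↔ (y = y₁ ∨ y = y₂) := by
  have hm : ∀ i, ∃ m ∈ τ, ∀ x ∈ τ, k i m ≤ k i x := fun i =>
    Finset.exists_min_image τ (k i) ⟨t, ht⟩
  choose m hmτ hmle using hm
  have hsurj : ∀ x ∈ τ, ∃ i, m i = x := by
    intro x hx
    obtain ⟨i, hi⟩ := hτ x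
    exact ⟨i, hk i (le_antisymm (hmle i x hx) (hi _ (hmτ i)))⟩
  obtain ⟨i, -, j, -, hij, hmij⟩ : ∃ i ∈ (Finset.univ : Finset I), ∃ j ∈ (Finset.univ : Finset I),
      i ≠ j ∧ m i = m j := by
    apply Finset.exists_ne_map_eq_of_card_lt_of_maps_to (t := τ)
    · rw [Finset.card_univ]; omega
    · intro a _; exact hmτ a
  have hinj : ∀ i j, i ≠ j → m i = m j → ∀ a b, a ≠ i → b ≠ i → m a = m b → a = b := by
    intro i j hij hmij a b ha hb hab
    have him : (Finset.univ.erase i).image m = τ := by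
      ext x
      simp only [Finset.mem_image, Finset.mem_erase, Finset.mem_univ, and_true]
      constructor
      · rintro ⟨a, _, rfl⟩; exact hmτ a
      · intro hx
        obtain ⟨a, rfl⟩ := hsurj x hx
        by_cases h : a = i
        · exact ⟨j, hij.symm, by rw [h, hmij]⟩
        · exact ⟨a, h, rfl⟩
    have hci : ((Finset.univ.erase i).image m).card = (Finset.univ.erase i).card := by
      rw [him, Finset.card_erase_of_mem (Finset.mem_univ _), Finset.card_univ]; omega
    exact Finset.injOn_of_card_image_eq hci (by simpa using ha) (by simpa using hb) hab
  have hpair : ∀ a b, a ≠ b → m a = m b → (a = i ∧ b = j) ∨ (a = j ∧ b = i) := by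
    intro a b hab h
    have h1 := hinj i j hij hmij a b
    have h2 := hinj j i hij.symm hmij.symm a b
    grind
  -- the maximal elements
  have hM : ∀ l, ∃ y, (∀ l', l' ≠ l → k l' (m l') < k l' y) ∧
      ∀ z, (∀ l', l' ≠ l → k l' (m l') < k l' z) → k l z ≤ k l y := by
    intro l
    classical
    obtain ⟨y, hy, hy2⟩ := Finset.exists_max_image
      (Finset.univ.filter (fun y => ∀ l', l' ≠ l → k l' (m l') < k l' y)) (k l)
      ⟨e l, by
        simp only [Finset.mem_filter, Finset.mem_univ, true_and]
        intro l' hl'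
        exact lt_of_le_of_lt (hmle l' t ht) (he2 l' l hl'.symm t hte)⟩
    simp only [Finset.mem_filter, Finset.mem_univ, true_and] at hy hy2
    exact ⟨y, hy, hy2⟩
  choose Y hY1 hY2 using hM
  have hA : ∀ l l', l ≠ l' → m l = m l' →
      Y l ∉ τ ∧ k l (Y l) < k l (m l) ∧ Dom k (insert (Y l) τ) := by
    intro l l' hll hml
    have hn : Y l ∉ τ := by
      intro hmem
      obtain ⟨a, ha⟩ := hsurj _ hmem
      by_cases hal : a = l
      · have := hY1 l l' hll.symm
        rw [← ha, hal, hml] at this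
        exact lt_irrefl _ this
      · have := hY1 l a hal
        rw [← ha] at this
        exact lt_irrefl _ this
    have hlt : k l (Y l) < k l (m l) := by
      obtain ⟨a, ha⟩ := hτ (Y l)
      by_cases hal : a = l
      · subst hal
        refine lt_of_le_of_ne (ha _ (hmτ a)) ?_
        intro h
        exact hn (hk _ h ▸ hmτ a)
      · exact absurd (ha _ (hmτ a)) (not_le.2 (hY1 l a hal))
    refine ⟨hn, hlt, ?_⟩
    intro z
    by_cases hz : ∀ l', l' ≠ l → k l' (m l') < k l' z
    · refine ⟨l, ?_⟩
      intro x hx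
      rw [Finset.mem_insert] at hx
      rcases hx with rfl | hx
      · exact hY2 l z hz
      · exact (hY2 l z hz).trans (hlt.le.trans (hmle l x hx))
    · push Not at hz
      obtain ⟨a, hal, ha⟩ := hz
      refine ⟨a, ?_⟩
      intro x hx
      rw [Finset.mem_insert] at hx
      rcases hx with rfl | hx
      · exact ha.trans (hY1 l a hal).le
      · exact ha.trans (hmle a x hx)
  obtain ⟨ai1, ai2, ai3⟩ := hA i j hij hmij
  obtain ⟨aj1, aj2, aj3⟩ := hA j i hij.symm hmij.symm
  refine ⟨Y i, Y j, ?_, ?_⟩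
  · intro h
    have := hY1 j i hij
    rw [← h] at this
    exact lt_asymm this ai2
  · intro y
    constructor
    · rintro ⟨hyτ, hy⟩
      obtain ⟨a, ha⟩ := hy y
      have hlt : k a y < k a (m a) := by
        refine lt_of_le_of_ne (ha _ (Finset.mem_insert_of_mem (hmτ a))) ?_
        intro h
        exact hyτ (hk _ h ▸ hmτ a)
      -- any index where y is a new minimum is i or j
      have key : ∀ l, k l y < k l (m l) → ∃ b, b ≠ l ∧ m b = m l ∧ k b (m b) ≤ k b y := by
        intro l hl
        obtain ⟨b, hb⟩ := hy (m l)
        have hby := hb y (Finset.mem_insert_self _ _)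
        have hmb : m b = m l :=
          hk b (le_antisymm (hmle b _ (hmτ l)) (hb _ (Finset.mem_insert_of_mem (hmτ b))))
        refine ⟨b, ?_, hmb, by rw [hmb]; exact hby⟩
        rintro rfl
        exact absurd hby (not_le.2 hl)
      have hyM : ∀ l', l' ≠ a → k l' (m l') < k l' y := by
        intro l' hl'
        by_contra hcon
        have hlt' : k l' y < k l' (m l') := by
          refine lt_of_le_of_ne (not_lt.1 hcon) ?_
          intro h
          exact hyτ (hk _ h ▸ hmτ l')
        obtain ⟨b, hb, hb2, hb3⟩ := key a hlt
        obtain ⟨d, hd, hd2, hd3⟩ := key l' hlt'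
        have hda : d ≠ a := by
          rintro rfl
          exact absurd hd3 (not_le.2 hlt)
        have h1 := hpair b a hb hb2
        have h2 := hpair d l' hd hd2
        grind
      have hmax : ∀ z, (∀ l', l' ≠ a → k l' (m l') < k l' z) → k a z ≤ k a y := by
        intro z hz
        obtain ⟨b, hb⟩ := hy z
        by_cases hba : b = a
        · subst hba; exact hb y (Finset.mem_insert_self _ _)
        · exact absurd (hb _ (Finset.mem_insert_of_mem (hmτ b))) (not_le.2 (hz b hba))
      have hya : y = Y a := hk a (le_antisymm (hY2 a y hyM) (hmax _ (hY1 a)))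
      obtain ⟨b, hb, hb2, hb3⟩ := key a hlt
      have h1 := hpair b a hb hb2
      grind
    · rintro (rfl | rfl)
      · exact ⟨ai1, ai3⟩
      · exact ⟨aj1, aj3⟩

theorem scarf {V I L : Type*} [Fintype V] [DecidableEq V] [Fintype I] [DecidableEq I]
    [LinearOrder L] [Nonempty I] (k : I → V → L) (hk : ∀ i, Function.Injective (k i)) (e : I → V)
    (he1 : ∀ i v, k i (e i) ≤ k i v)
    (he2 : ∀ i j, j ≠ i → ∀ v, v ∉ Set.range e → k i v < k i (e j))
    (hT : ∃ v, v ∉ Set.range e) (c : V → I) (hc : ∀ i, c (e i) = i) :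
    ∃ σ : Finset V, Dom k σ ∧ σ.card = Fintype.card I ∧ σ.image c = Finset.univ := by
  classical
  by_contra hno
  push Not at hno
  obtain ⟨i₀⟩ := ‹Nonempty I›
  have heinj : Function.Injective e := fun a b h => by rw [← hc a, h, hc]
  let D : Finset (Finset V) := Finset.univ.filter
    (fun τ => Dom k τ ∧ τ.card + 1 = Fintype.card I ∧ τ.image c = Finset.univ.erase i₀)
  let R : Finset (Finset V) := Finset.univ.filter
    (fun σ => Dom k σ ∧ σ.card = Fintype.card I)
  have hD : ∀ τ, τ ∈ D ↔
      Dom k τ ∧ τ.card + 1 = Fintype.card I ∧ τ.image c = Finset.univ.erase i₀ := by simp [D]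
  have hR : ∀ σ, σ ∈ R ↔ Dom k σ ∧ σ.card = Fintype.card I := by simp [R]
  have hsub : ∀ σ τ : Finset V, τ ⊆ σ → Dom k σ → Dom k τ := by
    intro σ τ h hσ y
    obtain ⟨i, hi⟩ := hσ y
    exact ⟨i, fun x hx => hi x (h hx)⟩
  have hdc := Finset.sum_card_bipartiteAbove_eq_sum_card_bipartiteBelow
    (s := D) (t := R) (fun τ σ => τ ⊆ σ)
  -- rooms above a door
  have hrooms : ∀ τ ∈ D, ∀ Y : Finset V, (∀ y, (y ∉ τ ∧ Dom k (insert y τ)) ↔ y ∈ Y) →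
      (R.bipartiteAbove (fun τ σ => τ ⊆ σ) τ).card = Y.card := by
    intro τ hτ Y hY
    rw [hD] at hτ
    have : R.bipartiteAbove (fun τ σ => τ ⊆ σ) τ = Y.image (fun y => insert y τ) := by
      ext σ
      rw [Finset.mem_bipartiteAbove, hR, Finset.mem_image]
      constructor
      · rintro ⟨⟨h1, h2⟩, h3⟩
        obtain ⟨y, hy, hyσ⟩ := (Finset.exists_eq_insert_iff (s := τ) (t := σ)).2
          ⟨h3, by omega⟩
        exact ⟨y, (hY y).1 ⟨hy, by rw [hyσ]; exact h1⟩, hyσ⟩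
      · rintro ⟨y, hy, rfl⟩
        obtain ⟨h1, h2⟩ := (hY y).2 hy
        exact ⟨⟨h2, by rw [Finset.card_insert_of_notMem h1]; exact hτ.2.1⟩,
          Finset.subset_insert _ _⟩
    rw [this, Finset.card_image_of_injOn]
    intro y hy z hz hyz
    have h1 := ((hY y).2 hy).1
    have h2 : y ∈ insert z τ := by
      have : insert y τ = insert z τ := hyz
      rw [← this]; exact Finset.mem_insert_self _ _
    rcases Finset.mem_insert.1 h2 with h | h
    · exact h
    · exact absurd h h1
  -- each room has an even number of doors
  have heven : ∀ σ ∈ R, 2 ∣ (D.bipartiteBelow (fun τ σ => τ ⊆ σ) σ).card := by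
    intro σ hσ
    rw [hR] at hσ
    have hnc := hno σ hσ.1 hσ.2
    rcases (D.bipartiteBelow (fun τ σ => τ ⊆ σ) σ).eq_empty_or_nonempty with h0 | ⟨τ, hτ⟩
    · simp [h0]
    rw [Finset.mem_bipartiteBelow, hD] at hτ
    obtain ⟨⟨hτ1, hτ2, hτ3⟩, hτσ⟩ := hτ
    obtain ⟨x, hx, rfl⟩ := (Finset.exists_eq_insert_iff (s := τ) (t := σ)).2 ⟨hτσ, by omega⟩
    have hcx : c x ≠ i₀ := by
      intro h
      apply hnc
      rw [Finset.image_insert, hτ3, h, Finset.insert_erase (Finset.mem_univ _)]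
    have hcinj : Set.InjOn c τ := by
      apply Finset.injOn_of_card_image_eq
      rw [hτ3, Finset.card_erase_of_mem (Finset.mem_univ _), Finset.card_univ]; omega
    obtain ⟨x', hx', hcx'⟩ : ∃ x' ∈ τ, c x' = c x := by
      rw [← Finset.mem_image, hτ3]; simpa using hcx
    have hne : x ≠ x' := by rintro rfl; exact hx hx'
    have : D.bipartiteBelow (fun τ σ => τ ⊆ σ) (insert x τ) = {τ, (insert x τ).erase x'} := by
      ext ρ
      rw [Finset.mem_bipartiteBelow, hD, Finset.mem_insert, Finset.mem_singleton]
      constructor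
      · rintro ⟨⟨h1, h2, h3⟩, h4⟩
        obtain ⟨z, hz, hzρ⟩ := (Finset.exists_eq_insert_iff (s := ρ) (t := insert x τ)).2
          ⟨h4, by rw [Finset.card_insert_of_notMem hx]; omega⟩
        have hρ : ρ = (insert x τ).erase z := by rw [← hzρ, Finset.erase_insert hz]
        have hzm : z ∈ insert x τ := by rw [← hzρ]; exact Finset.mem_insert_self _ _
        have hρinj : Set.InjOn c ρ := by
          apply Finset.injOn_of_card_image_eq
          rw [h3, Finset.card_erase_of_mem (Finset.mem_univ _), Finset.card_univ]; omega
        by_cases hzx : z = x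
        · left; rw [hρ, hzx, Finset.erase_insert hx]
        · right
          by_cases hzx' : z = x'
          · rw [hρ, hzx']
          · exfalso
            apply hne
            apply hρinj _ _ hcx'.symm
            · rw [hρ]; simp [Ne.symm hzx]
            · rw [hρ]; simp [Ne.symm hzx', hx']
      · rintro (rfl | rfl)
        · exact ⟨⟨hτ1, hτ2, hτ3⟩, hτσ⟩
        · refine ⟨⟨hsub _ _ (Finset.erase_subset _ _) hσ.1, ?_, ?_⟩, Finset.erase_subset _ _⟩
          · rw [Finset.card_erase_of_mem (Finset.mem_insert_of_mem hx'),
              Finset.card_insert_of_notMem hx]; omega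
          · rw [← hτ3]
            ext a
            simp only [Finset.mem_image, Finset.mem_erase, Finset.mem_insert]
            constructor
            · rintro ⟨b, ⟨hb1, rfl | hb2⟩, rfl⟩
              · exact ⟨x', hx', hcx'⟩
              · exact ⟨b, hb2, rfl⟩
            · rintro ⟨b, hb, rfl⟩
              by_cases hbx : b = x'
              · exact ⟨x, ⟨hne, Or.inl rfl⟩, by rw [hbx, hcx']⟩
              · exact ⟨b, ⟨hbx, Or.inr hb⟩, rfl⟩
    rw [this, Finset.card_pair]
    intro h
    have : x' ∈ (insert x τ).erase x' := h ▸ hx'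
    simp at this
  -- outer door
  let O : Finset V := (Finset.univ.erase i₀).image e
  obtain ⟨v₀, hv₀⟩ := hT
  obtain ⟨w, hw, hwmax⟩ := Finset.exists_max_image
    (Finset.univ.filter (fun v => v ∉ Set.range e)) (k i₀) ⟨v₀, by simpa using hv₀⟩
  simp only [Finset.mem_filter, Finset.mem_univ, true_and] at hw hwmax
  have hOmem : ∀ x, x ∈ O ↔ ∃ a, a ≠ i₀ ∧ e a = x := by simp [O]
  have hwO : w ∉ O := by
    rw [hOmem]; rintro ⟨a, _, h⟩; exact hw ⟨a, h⟩
  have hwdom : Dom k (insert w O) := by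
    intro z
    by_cases hz : z ∈ Set.range e
    · obtain ⟨a, rfl⟩ := hz
      exact ⟨a, fun x _ => he1 a x⟩
    · refine ⟨i₀, fun x hx => ?_⟩
      rcases Finset.mem_insert.1 hx with rfl | hx
      · exact hwmax z hz
      · obtain ⟨a, ha, rfl⟩ := (hOmem x).1 hx
        exact (he2 i₀ a ha z hz).le
  have hpos : 0 < Fintype.card I := Fintype.card_pos_iff.2 ⟨i₀⟩
  have hOD : O ∈ D := by
    rw [hD]
    refine ⟨hsub _ _ (Finset.subset_insert _ _) hwdom, ?_, ?_⟩
    · rw [Finset.card_image_of_injective _ heinj, Finset.card_erase_of_mem (Finset.mem_univ _),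
        Finset.card_univ]; omega
    · rw [Finset.image_image]
      have : c ∘ e = id := funext hc
      rw [this, Finset.image_id]
  have hOone : (R.bipartiteAbove (fun τ σ => τ ⊆ σ) O).card = 1 := by
    rw [hrooms O hOD {w}, Finset.card_singleton]
    intro y
    rw [Finset.mem_singleton]
    constructor
    · rintro ⟨hy, hyd⟩
      have hgen : ∀ z, z ∉ Set.range e → k i₀ z ≤ k i₀ y := by
        intro z hz
        obtain ⟨b, hb⟩ := hyd z
        by_cases hbi : b = i₀
        · subst hbi; exact hb y (Finset.mem_insert_self _ _)
        · exfalso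
          have h1 := hb (e b) (Finset.mem_insert_of_mem ((hOmem _).2 ⟨b, hbi, rfl⟩))
          exact hz ⟨b, hk b (le_antisymm (he1 b z) h1)⟩
      have hyr : y ∉ Set.range e := by
        rintro ⟨a, rfl⟩
        by_cases hai : a = i₀
        · subst hai
          exact hw ⟨a, hk a (le_antisymm (he1 a w) (hgen w hw))⟩
        · exact hy ((hOmem _).2 ⟨a, hai, rfl⟩)
      exact hk i₀ (le_antisymm (hwmax y hyr) (hgen w hw))
    · rintro rfl; exact ⟨hwO, hwdom⟩
  have hinner : ∀ τ ∈ D.erase O, 2 ∣ (R.bipartiteAbove (fun τ σ => τ ⊆ σ) τ).card := by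
    intro τ hτ
    obtain ⟨hτO, hτD⟩ := Finset.mem_erase.1 hτ
    obtain ⟨h1, h2, h3⟩ := (hD τ).1 hτD
    by_cases hex : ∃ t ∈ τ, t ∉ Set.range e
    · obtain ⟨t, ht, hte⟩ := hex
      obtain ⟨y₁, y₂, hne, hy⟩ := inner k hk e he2 τ h1 h2 t ht hte
      rw [hrooms τ hτD {y₁, y₂} (by intro y; rw [hy y]; simp), Finset.card_pair hne]
    · exfalso
      push Not at hex
      apply hτO
      ext x
      rw [hOmem]
      constructor
      · intro hx
        obtain ⟨a, rfl⟩ := hex x hx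
        refine ⟨a, ?_, rfl⟩
        have : c (e a) ∈ τ.image c := Finset.mem_image_of_mem _ hx
        rw [h3, hc] at this
        exact (Finset.mem_erase.1 this).1
      · rintro ⟨a, ha, rfl⟩
        have : a ∈ τ.image c := by rw [h3]; simpa using ha
        obtain ⟨x, hx, rfl⟩ := Finset.mem_image.1 this
        obtain ⟨b, rfl⟩ := hex x hx
        rw [hc]; exact hx
  have h1 := Finset.dvd_sum heven
  have h2 := Finset.dvd_sum hinner
  rw [← hdc, ← Finset.add_sum_erase _ _ hOD, hOone] at h1
  omega

end Scarf

namespace Scarf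

theorem brouwer_approx {ι : Type*} [Fintype ι] [Nonempty ι] (f : (ι → ℝ) → (ι → ℝ))
    (hf : ContinuousOn f (stdSimplex ℝ ι)) (hmap : Set.MapsTo f (stdSimplex ℝ ι) (stdSimplex ℝ ι))
    (δ : ℝ) (hδ : 0 < δ) :
    ∃ x ∈ stdSimplex ℝ ι, ∀ i, x i - δ ≤ f x i := by
  classical
  have hcomp : IsCompact (stdSimplex ℝ ι) := isCompact_stdSimplex ℝ ι
  have huc := hcomp.uniformContinuousOn_of_continuous hf
  rw [Metric.uniformContinuousOn_iff] at huc
  obtain ⟨η, hη, huc⟩ := huc (δ / 2) (by positivity)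
  set n : ℝ := (Fintype.card ι : ℝ) with hn
  have hnpos : 0 < n := by
    rw [hn]; exact_mod_cast Fintype.card_pos
  set β : ℝ := min (η / 2) (δ / 2) with hβ
  have hβpos : 0 < β := by positivity
  have hβη : β < η := lt_of_le_of_lt (min_le_left _ _) (by linarith)
  have hβδ : β ≤ δ / 2 := min_le_right _ _
  set ε : ℝ := β / n with hε
  have hεpos : 0 < ε := by positivity
  have hnε : n * ε = β := by rw [hε]; field_simp
  obtain ⟨t, htsub, htfin, htcov⟩ := hcomp.finite_cover_balls hεpos
  have : Finite t := htfin
  have : Fintype t := Fintype.ofFinite t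
  have hnet : ∀ p ∈ stdSimplex ℝ ι, ∃ y : t, dist p y < ε := by
    intro p hp
    have := htcov hp
    simp only [Set.mem_iUnion, Metric.mem_ball, exists_prop] at this
    obtain ⟨y, hy, h⟩ := this
    exact ⟨⟨y, hy⟩, h⟩
  have hts : ∀ y : t, (y : ι → ℝ) ∈ stdSimplex ℝ ι := fun y => htsub y.2
  have hle1 : ∀ x ∈ stdSimplex ℝ ι, ∀ i, x i ≤ 1 := by
    intro x hx i
    rw [← hx.2]
    exact Finset.single_le_sum (fun j _ => hx.1 j) (Finset.mem_univ i)
  let h : ι → (t ⊕ ι) → ℝ := fun i v => Sum.elim (fun y : t => (y : ι → ℝ) i)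
    (fun j => if j = i then -1 else 2) v
  let k : ι → (t ⊕ ι) → ℝ ×ₗ Fin (Fintype.card (t ⊕ ι)) := fun i v =>
    toLex (h i v, Fintype.equivFin (t ⊕ ι) v)
  have hk : ∀ i, Function.Injective (k i) := by
    intro i a b hab
    have := congrArg (fun z => (ofLex z).2) hab
    simpa [k] using this
  have hklt : ∀ i a b, h i a < h i b → k i a < k i b := by
    intro i a b hab
    exact Prod.Lex.toLex_lt_toLex.2 (Or.inl hab)
  have hkle : ∀ i a b, k i a ≤ k i b → h i a ≤ h i b := by
    intro i a b hab
    by_contra hcon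
    exact absurd hab (not_le.2 (hklt i b a (not_le.1 hcon)))
  have hcol : ∀ x ∈ stdSimplex ℝ ι, ∃ i, x i ≤ f x i := by
    intro x hx
    by_contra hcon
    push Not at hcon
    have h1 : ∑ i, f x i < ∑ i, x i :=
      Finset.sum_lt_sum_of_nonempty Finset.univ_nonempty (fun i _ => hcon i)
    rw [hx.2, (hmap hx).2] at h1
    exact lt_irrefl _ h1
  choose! col hcol using hcol
  let c : (t ⊕ ι) → ι := Sum.elim (fun y => col y) id
  obtain ⟨y₀, -⟩ := hnet _ (single_mem_stdSimplex ℝ (Classical.arbitrary ι))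
  obtain ⟨σ, hdom, hcard, himg⟩ := scarf k hk Sum.inr
    (by
      rintro i (y | j)
      · refine (hklt _ _ _ ?_).le
        have := (hts y).1 i
        simp only [h, Sum.elim_inl, Sum.elim_inr, if_true]
        linarith
      · by_cases hj : j = i
        · rw [hj]
        · refine (hklt _ _ _ ?_).le
          simp only [h, Sum.elim_inr, if_true, hj, if_false]
          norm_num)
    (by
      rintro i j hj (y | l) hv
      · apply hklt
        have := hle1 _ (hts y) i
        simp only [h, Sum.elim_inl, Sum.elim_inr, hj, if_false]
        linarith
      · exact absurd ⟨l, rfl⟩ hv)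
    ⟨Sum.inl y₀, by simp⟩ c (fun i => rfl)
  -- the index set C
  let C : Finset ι := Finset.univ.filter (fun i => Sum.inr i ∉ σ)
  have hC : ∀ i, i ∈ C ↔ Sum.inr i ∉ σ := by simp [C]
  let S : Finset t := Finset.univ.filter (fun y => Sum.inl y ∈ σ)
  have hS : ∀ y, y ∈ S ↔ Sum.inl y ∈ σ := by simp [S]
  have hdomC : ∀ y : t, ∃ i ∈ C, ∀ x ∈ S, (y : ι → ℝ) i ≤ (x : ι → ℝ) i := by
    intro y
    obtain ⟨i, hi⟩ := hdom (Sum.inl y)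
    refine ⟨i, ?_, ?_⟩
    · rw [hC]
      intro hmem
      have h1 := hkle _ _ _ (hi _ hmem)
      simp only [h, Sum.elim_inl, Sum.elim_inr, if_true] at h1
      have := (hts y).1 i
      linarith
    · intro x hx
      have h1 := hkle _ _ _ (hi _ ((hS x).1 hx))
      simpa [h] using h1
  have hcolC : ∀ i ∈ C, ∃ x ∈ S, col x = i := by
    intro i hi
    have : i ∈ σ.image c := by rw [himg]; exact Finset.mem_univ _
    obtain ⟨v, hv, hvi⟩ := Finset.mem_image.1 this
    rcases v with y | j
    · exact ⟨y, (hS y).2 hv, hvi⟩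
    · have : j = i := hvi
      subst this
      exact absurd hv ((hC j).1 hi)
  obtain ⟨i₁, hi₁, -⟩ := hdomC y₀
  obtain ⟨x₁, hx₁, -⟩ := hcolC i₁ hi₁
  have hm : ∀ i, ∃ z ∈ S, ∀ x ∈ S, (z : ι → ℝ) i ≤ (x : ι → ℝ) i := fun i =>
    Finset.exists_min_image S (fun x : t => (x : ι → ℝ) i) ⟨x₁, hx₁⟩
  choose z hzS hzle using hm
  let m : ι → ℝ := fun i => (z i : ι → ℝ) i
  have hm0 : ∀ i, 0 ≤ m i := fun i => (hts (z i)).1 i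
  have hCcard : (0 : ℝ) < C.card := by exact_mod_cast Finset.card_pos.2 ⟨i₁, hi₁⟩
  have hCn : (C.card : ℝ) ≤ n := by rw [hn]; exact_mod_cast Finset.card_le_univ C
  have hsum : 1 - β ≤ ∑ i ∈ C, m i := by
    by_contra hcon
    push Not at hcon
    set s : ℝ := 1 - ∑ i ∈ C, m i with hs
    have hsβ : β < s := by linarith
    let p : ι → ℝ := fun i => if i ∈ C then m i + s / C.card else 0
    have hp : p ∈ stdSimplex ℝ ι := by
      constructor
      · intro i
        simp only [p]
        split_ifs
        · have := hm0 i
          have : 0 < s := by linarith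
          positivity
        · exact le_rfl
      · simp only [p]
        rw [Finset.sum_ite_mem, Finset.univ_inter, Finset.sum_add_distrib, Finset.sum_const,
          nsmul_eq_mul, mul_div_cancel₀ _ hCcard.ne', hs]
        ring
    obtain ⟨y, hy⟩ := hnet p hp
    obtain ⟨i, hi, hle⟩ := hdomC y
    have h1 : (y : ι → ℝ) i ≤ m i := hle _ (hzS i)
    have h2 : |p i - (y : ι → ℝ) i| < ε := by
      rw [← Real.dist_eq]
      exact lt_of_le_of_lt (dist_le_pi_dist _ _ i) hy
    have h3 : p i = m i + s / C.card := by simp [p, hi]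
    have h4 : ε < s / C.card := by
      rw [lt_div_iff₀ hCcard]
      calc ε * C.card ≤ ε * n := by gcongr
        _ = β := by rw [mul_comm, hnε]
        _ < s := hsβ
    rw [h3] at h2
    have := (abs_lt.1 h2).2
    linarith
  have hxsum : ∀ x ∈ S, ∀ i, (i ∈ C → (x : ι → ℝ) i ≤ m i + β) ∧ (i ∉ C → (x : ι → ℝ) i ≤ β) := by
    intro x hx i
    have hx1 := hts x
    have hle : ∀ j, m j ≤ (x : ι → ℝ) j := fun j => hzle j x hx
    have hCs : ∑ j ∈ C, (x : ι → ℝ) j ≤ 1 := by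
      rw [← hx1.2]
      exact Finset.sum_le_sum_of_subset_of_nonneg (Finset.subset_univ _) (fun j _ _ => hx1.1 j)
    constructor
    · intro hi
      have : (x : ι → ℝ) i - m i ≤ ∑ j ∈ C, ((x : ι → ℝ) j - m j) :=
        Finset.single_le_sum (f := fun j => (x : ι → ℝ) j - m j)
          (fun j _ => sub_nonneg.2 (hle j)) hi
      rw [Finset.sum_sub_distrib] at this
      linarith
    · intro hi
      have h1 : ∑ j ∈ insert i C, (x : ι → ℝ) j ≤ 1 := by
        rw [← hx1.2]
        exact Finset.sum_le_sum_of_subset_of_nonneg (Finset.subset_univ _) (fun j _ _ => hx1.1 j)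
      rw [Finset.sum_insert hi] at h1
      have h2 : ∑ j ∈ C, m j ≤ ∑ j ∈ C, (x : ι → ℝ) j := Finset.sum_le_sum (fun j _ => hle j)
      linarith
  have hclose : ∀ x ∈ S, ∀ x' ∈ S, ∀ i, (x : ι → ℝ) i - (x' : ι → ℝ) i ≤ β := by
    intro x hx x' hx' i
    by_cases hi : i ∈ C
    · have h1 := (hxsum x hx i).1 hi
      have h2 : m i ≤ (x' : ι → ℝ) i := hzle i x' hx'
      linarith
    · have h1 := (hxsum x hx i).2 hi
      have h2 := (hts x').1 i
      linarith
  refine ⟨x₁, hts x₁, fun i => ?_⟩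
  by_cases hi : i ∈ C
  · obtain ⟨x, hx, hxi⟩ := hcolC i hi
    have h1 := hcol x (hts x)
    rw [hxi] at h1
    have hd : dist (x : ι → ℝ) x₁ < η := by
      refine lt_of_le_of_lt ((dist_pi_le_iff hβpos.le).2 ?_) hβη
      intro j
      rw [Real.dist_eq, abs_le]
      have := hclose x hx x₁ hx₁ j
      have := hclose x₁ hx₁ x hx j
      constructor <;> linarith
    have h2 := lt_of_le_of_lt (dist_le_pi_dist _ _ i) (huc _ (hts x) _ (hts x₁) hd)
    rw [Real.dist_eq] at h2
    have := (abs_lt.1 h2).2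
    have := hclose x₁ hx₁ x hx i
    linarith
  · have h1 := (hxsum x₁ hx₁ i).2 hi
    have h2 := (hmap (hts x₁)).1 i
    linarith

theorem brouwer {ι : Type*} [Fintype ι] [Nonempty ι] (f : (ι → ℝ) → (ι → ℝ))
    (hf : ContinuousOn f (stdSimplex ℝ ι))
    (hmap : Set.MapsTo f (stdSimplex ℝ ι) (stdSimplex ℝ ι)) :
    ∃ x ∈ stdSimplex ℝ ι, f x = x := by
  classical
  have hcomp : IsCompact (stdSimplex ℝ ι) := isCompact_stdSimplex ℝ ι
  obtain ⟨x, hx, hmin⟩ := hcomp.exists_isMinOn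
    ⟨_, single_mem_stdSimplex ℝ (Classical.arbitrary ι)⟩
    (f := fun x => ‖f x - x‖) (hf.sub continuousOn_id).norm
  refine ⟨x, hx, ?_⟩
  by_contra hne
  have hpos : 0 < ‖f x - x‖ := norm_pos_iff.2 (sub_ne_zero.2 hne)
  set n : ℝ := (Fintype.card ι : ℝ) with hn
  have hnpos : 0 < n := by
    rw [hn]; exact_mod_cast Fintype.card_pos
  set δ := ‖f x - x‖ / (2 * n) with hδ
  have hδpos : 0 < δ := by positivity
  obtain ⟨w, hw, hwi⟩ := brouwer_approx f hf hmap δ hδpos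
  have h1 : ‖f x - x‖ ≤ ‖f w - w‖ := hmin hw
  have h2 : ‖f w - w‖ ≤ n * δ := by
    have hn1 : 1 ≤ n := by
      rw [hn]; exact_mod_cast (Fintype.card_pos : 0 < Fintype.card ι)
    rw [pi_norm_le_iff_of_nonneg (by positivity)]
    intro i
    rw [Real.norm_eq_abs, abs_le, Pi.sub_apply]
    constructor
    · have := hwi i
      nlinarith
    · have h3 : f w i - w i + δ ≤ ∑ j, (f w j - w j + δ) :=
        Finset.single_le_sum (f := fun j => f w j - w j + δ)
          (fun j _ => by have := hwi j; linarith) (Finset.mem_univ i)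
      rw [Finset.sum_add_distrib, Finset.sum_sub_distrib, hw.2, (hmap hw).2, Finset.sum_const,
        nsmul_eq_mul, Finset.card_univ] at h3
      linarith
  have h3 : n * δ = ‖f x - x‖ / 2 := by rw [hδ]; field_simp
  linarith

theorem schauder_approx {X : Type*} [NormedAddCommGroup X] [NormedSpace ℝ X]
    (U : Set X) (hne : U.Nonempty) (hcv : Convex ℝ U)
    (T : X → X) (hmaps : Set.MapsTo T U U) (hcont : ContinuousOn T U)
    (htb : TotallyBounded (T '' U)) (ε : ℝ) (hε : 0 < ε) :
    ∃ x ∈ U, dist (T x) x ≤ ε := by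
  classical
  obtain ⟨t, htsub, htfin, htcov⟩ := Metric.finite_approx_of_totallyBounded htb ε hε
  have : Finite t := htfin
  have : Fintype t := Fintype.ofFinite t
  have hnet : ∀ x ∈ U, ∃ y : t, dist (T x) y < ε := by
    intro x hx
    have := htcov (Set.mem_image_of_mem T hx)
    simp only [Set.mem_iUnion, Metric.mem_ball, exists_prop] at this
    obtain ⟨y, hy, h⟩ := this
    exact ⟨⟨y, hy⟩, h⟩
  have htU : ∀ y : t, (y : X) ∈ U := by
    intro y
    obtain ⟨x, hx, h⟩ := htsub y.2
    rw [← h]; exact hmaps hx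
  obtain ⟨u, hu⟩ := hne
  have : Nonempty t := ⟨(hnet u hu).choose⟩
  let g : (t → ℝ) → X := fun w => ∑ i, w i • (i : X)
  have hgU : ∀ w ∈ stdSimplex ℝ t, g w ∈ U := by
    intro w hw
    exact hcv.sum_mem (fun i _ => hw.1 i) hw.2 (fun i _ => htU i)
  have hgc : Continuous g := by fun_prop
  let μ : X → t → ℝ := fun x i => max (ε - dist x i) 0
  have hμ0 : ∀ x i, 0 ≤ μ x i := fun x i => le_max_right _ _
  have hμpos : ∀ x ∈ U, 0 < ∑ i, μ (T x) i := by
    intro x hx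
    obtain ⟨y, hy⟩ := hnet x hx
    exact Finset.sum_pos' (fun i _ => hμ0 _ i)
      ⟨y, Finset.mem_univ _, lt_max_of_lt_left (by linarith)⟩
  let f : (t → ℝ) → (t → ℝ) := fun w i => μ (T (g w)) i / ∑ j, μ (T (g w)) j
  have hTg : ContinuousOn (fun w => T (g w)) (stdSimplex ℝ t) :=
    hcont.comp hgc.continuousOn hgU
  have hμc : ∀ i, ContinuousOn (fun w => μ (T (g w)) i) (stdSimplex ℝ t) := by
    intro i
    have : Continuous (fun x => μ x i) := by fun_prop
    exact this.comp_continuousOn hTg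
  obtain ⟨w, hw, hfw⟩ := brouwer f
    (continuousOn_pi.2 fun i => (hμc i).div (continuousOn_finsetSum _ fun j _ => hμc j)
      (fun w hw => (hμpos _ (hgU w hw)).ne'))
    (fun w hw => ⟨fun i => div_nonneg (hμ0 _ _) (hμpos _ (hgU w hw)).le, by
      simp only [f]
      rw [← Finset.sum_div, div_self (hμpos _ (hgU w hw)).ne']⟩)
  refine ⟨g w, hgU w hw, ?_⟩
  have h1 : T (g w) - g w = ∑ i, w i • (T (g w) - (i : X)) := by
    simp only [smul_sub, Finset.sum_sub_distrib]
    rw [← Finset.sum_smul, hw.2, one_smul]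
  rw [dist_eq_norm, h1]
  calc ‖∑ i, w i • (T (g w) - (i : X))‖ ≤ ∑ i, ‖w i • (T (g w) - (i : X))‖ := norm_sum_le _ _
    _ ≤ ∑ i, w i * ε := by
      refine Finset.sum_le_sum fun i _ => ?_
      rw [norm_smul, Real.norm_of_nonneg (hw.1 i), ← dist_eq_norm]
      by_cases hd : dist (T (g w)) i ≤ ε
      · exact mul_le_mul_of_nonneg_left hd (hw.1 i)
      · have : w i = 0 := by
          rw [← hfw]
          have : μ (T (g w)) i = 0 := max_eq_right (by linarith)
          simp only [f, this, zero_div]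
        rw [this]; simp
    _ = ε := by rw [← Finset.sum_mul, hw.2, one_mul]

end Scarf

theorem stmt13 (X : Type*) [NormedAddCommGroup X] [NormedSpace ℝ X]
    [CompleteSpace X] (U : Set X) (hne : U.Nonempty) (hcl : IsClosed U)
    (hbd : Bornology.IsBounded U) (hcv : Convex ℝ U)
    (T : X → X) (hmaps : Set.MapsTo T U U) (hcont : ContinuousOn T U)
    (hcpt : IsCompact (closure (T '' U))) :
    ∃ x ∈ U, T x = x := by
  have htb : TotallyBounded (T '' U) := hcpt.totallyBounded.subset subset_closure
  have hap : ∀ n : ℕ, ∃ x ∈ U, dist (T x) x ≤ 1 / ((n : ℝ) + 1) := fun n =>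
    Scarf.schauder_approx U hne hcv T hmaps hcont htb _ (by positivity)
  choose x hxU hx using hap
  obtain ⟨z, hz, φ, hφ, hlim⟩ := hcpt.tendsto_subseq
    (fun n => subset_closure (Set.mem_image_of_mem T (hxU n)))
  have hzU : z ∈ U := closure_minimal hmaps.image_subset hcl hz
  have hd : Filter.Tendsto (fun n => dist (T (x (φ n))) (x (φ n))) Filter.atTop (nhds 0) :=
    (squeeze_zero (fun n => dist_nonneg) hx
      tendsto_one_div_add_atTop_nhds_zero_nat).comp hφ.tendsto_atTop
  have hxz : Filter.Tendsto (fun n => x (φ n)) Filter.atTop (nhds z) :=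
    (tendsto_iff_of_dist hd).1 hlim
  have hTz : Filter.Tendsto (fun n => T (x (φ n))) Filter.atTop (nhds (T z)) :=
    (hcont z hzU).tendsto.comp
      (tendsto_nhdsWithin_iff.2 ⟨hxz, Filter.Eventually.of_forall fun n => hxU _⟩)
  exact ⟨z, hzU, tendsto_nhds_unique hTz hlim⟩
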